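/- arXiv:2205.15584 — 9 statements merged into one kernel-verified Lean document; each statement's English description precedes it below -/
import Mathlib

section
/- Let k ≥ 3 be an integer and let H be the Hermitian adjacency matrix of a mixed graph on a finite vertex set V whose underlying graph G_H is a tree (i.e. G_H is connected and acyclic). Let A be the ordinary 0/1 adjacency matrix of G_H, viewed as a complex matrix (A u v = 1 if H u v ≠ 0 and u ≠ v, and A u v = 0 otherwise). Then H and A are cospectral, i.e. the characteristic polynomial of H equals the characteristic polynomial of A. -/
open Matrix

/-- Gains on a tree that are inverse along reversed edges are a coboundary: they are the quotients
of a potential on the vertices. -/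
theorem SimpleGraph.IsTree.exists_potential {V M : Type*} [CommMonoid M] {G : SimpleGraph V}
    (hG : G.IsTree) (g : V → V → M) (hg : ∀ u v, G.Adj u v → g u v * g v u = 1) :
    ∃ d : V → M, (∀ v, IsUnit (d v)) ∧ ∀ u v, G.Adj u v → d u * g u v = d v := by
  classical
  obtain ⟨r⟩ := hG.connected.nonempty
  choose p hp hpu using hG.existsUnique_path r
  have path_concat (u v : V) (h : G.Adj u v) (hu : u ∈ (p v).support) : p v = (p u).concat h :=
    hG.isAcyclic.path_concat (hp u) (hp v) h hu
  let d (v : V) : M := ((p v).darts.map fun e ↦ g e.fst e.snd).prod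
  have d_concat (u v : V) (h : G.Adj u v) (hu : u ∈ (p v).support) : d u * g u v = d v := by
    simp only [d]
    rw [path_concat u v h hu]
    simp [SimpleGraph.Walk.darts_concat]
  refine ⟨d, fun v ↦ ?_, fun u v h ↦ ?_⟩
  · refine List.prod_isUnit fun m hm ↦ ?_
    obtain ⟨e, -, rfl⟩ := List.mem_map.mp hm
    exact IsUnit.of_mul_eq_one _ (hg _ _ e.adj)
  · by_cases hu : u ∈ (p v).support
    · exact d_concat u v h hu
    · have hv : v ∈ (p u).support := by
        rw [← hpu u _ ((hp v).concat hu h.symm)]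
        simp [SimpleGraph.Walk.support_concat]
      rw [← d_concat v u h.symm hv, mul_assoc, hg v u h.symm, mul_one]

theorem Matrix.charpoly_eq_of_diagonal_mul_eq {n R : Type*} [Fintype n] [DecidableEq n]
    [CommRing R] {M N : Matrix n n R} (d : n → R) (hd : ∀ i, IsUnit (d i))
    (h : ∀ i j, d i * M i j = N i j * d j) : M.charpoly = N.charpoly := by
  obtain ⟨D, hD⟩ : IsUnit (diagonal d) := (Pi.isUnit_iff.mpr hd).map (diagonalRingHom n R)
  have hDMN : diagonal d * M = N * diagonal d := by
    ext i j
    rw [diagonal_mul, mul_diagonal, h]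
  rw [← charpoly_units_conj D M, hD, hDMN, ← hD, mul_assoc, ← coe_units_inv, Units.mul_inv, mul_one]

/-- A mixed graph (encoded by its Hermitian adjacency matrix `H` with entries in
`{0, 1, ω, conj ω}` for `ω = exp(2πi/k)`, `k ≥ 3`) whose underlying graph `G` is a tree
is cospectral with the ordinary 0/1 adjacency matrix `A` of `G`. -/
theorem stmt_0 {V : Type*} [Fintype V] [DecidableEq V] [Nonempty V]
    (k : ℕ) (hk : 3 ≤ k) (ω : ℂ)
    (hω : ω = Complex.exp (2 * (Real.pi : ℂ) * Complex.I / (k : ℂ)))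
    (H : Matrix V V ℂ) (hherm : H.IsHermitian) (hdiag : ∀ v, H v v = 0)
    (hent : ∀ u v, H u v ∈ ({0, 1, ω, (starRingEnd ℂ) ω} : Set ℂ))
    (G : SimpleGraph V) (hadj : ∀ u v, G.Adj u v ↔ u ≠ v ∧ H u v ≠ 0)
    (htree : G.IsTree)
    (A : Matrix V V ℂ)
    (hA1 : ∀ u v, G.Adj u v → A u v = 1)
    (hA0 : ∀ u v, ¬ G.Adj u v → A u v = 0) :
    H.charpoly = A.charpoly := by
  have hω_mul : ω * (starRingEnd ℂ) ω = 1 := by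
    have hnorm : ‖ω‖ = 1 := by
      have : 2 * (Real.pi : ℂ) * Complex.I / k = (2 * Real.pi / k : ℝ) * Complex.I := by
        push_cast
        ring
      rw [hω, this, Complex.norm_exp_ofReal_mul_I]
    rw [Complex.mul_conj, Complex.normSq_eq_norm_sq, hnorm]
    simp
  have hH_mul (u v : V) (h : G.Adj u v) : H u v * H v u = 1 := by
    rw [← hherm.apply v u]
    rcases hent u v with h0 | h1 | h2 | h3
    · exact absurd h0 ((hadj u v).mp h).2
    · simp [h1]
    · simpa [h2] using hω_mul
    · rw [Set.mem_singleton_iff.mp h3]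
      simpa [mul_comm] using hω_mul
  obtain ⟨d, hd, hd_adj⟩ := htree.exists_potential H hH_mul
  refine charpoly_eq_of_diagonal_mul_eq d hd fun u v ↦ ?_
  by_cases h : G.Adj u v
  · rw [hA1 u v h, hd_adj u v h, one_mul]
  · have hH : H u v = 0 := by
      by_contra hne
      exact h ((hadj u v).mpr ⟨fun huv ↦ hne (huv ▸ hdiag u), hne⟩)
    rw [hA0 u v h, hH, mul_zero, zero_mul]
end

section
/- Let k ≥ 3 be an integer and let H and H' be Hermitian adjacency matrices of two mixed graphs on the same finite vertex set V with the same underlying graph G (that is, for all u, v: H u v ≠ 0 iff H' u v ≠ 0, and G is the simple graph with u adjacent to v iff u ≠ v and H u v ≠ 0). Suppose that for every vertex v and every closed walk p from v to v in G that is a cycle, the real part of the weight of p in H equals the real part of the weight of p in H', where the weight of a walk in a matrix M is the product, over the darts (u,w) traversed by the walk, of the entries M u w. Then H and H' are cospectral, i.e. they have the same characteristic polynomial. -/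
namespace Equiv.Perm

theorem sameCycle_iff_exists_natPow {V : Type*} [Finite V] {σ : Equiv.Perm V} {i j : V} :
    σ.SameCycle i j ↔ ∃ n : ℕ, (σ ^ n) i = j :=
  ⟨fun h => h.exists_nat_pow_eq, fun ⟨n, hn⟩ => ⟨n, by simpa using hn⟩⟩

variable {V : Type*} [Fintype V] [DecidableEq V]

/-- The permutation obtained from `σ` by inverting its cycle through `v`. -/
def invCycleAt (v : V) (σ : Equiv.Perm V) : Equiv.Perm V :=
  σ * ((σ.cycleOf v)⁻¹) ^ 2

theorem sign_invCycleAt (v : V) (σ : Equiv.Perm V) : sign (invCycleAt v σ) = sign σ := by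
  simp [invCycleAt]

theorem invCycleAt_apply_of_sameCycle {v i : V} {σ : Equiv.Perm V} (h : σ.SameCycle v i) :
    invCycleAt v σ i = σ⁻¹ i := by
  have h1 : σ⁻¹.SameCycle v i := h.inv
  have h2 : σ⁻¹.SameCycle v (σ⁻¹ i) := sameCycle_apply_right.2 h1
  simp only [invCycleAt, pow_two, mul_apply, cycleOf_inv]
  rw [h1.cycleOf_apply, h2.cycleOf_apply]
  exact σ.apply_symm_apply _

theorem invCycleAt_apply_of_not_sameCycle {v i : V} {σ : Equiv.Perm V} (h : ¬ σ.SameCycle v i) :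
    invCycleAt v σ i = σ i := by
  have h1 : ¬ σ⁻¹.SameCycle v i := fun h' => h (sameCycle_inv.1 h')
  simp only [invCycleAt, pow_two, mul_apply, cycleOf_inv]
  rw [cycleOf_apply_of_not_sameCycle h1, cycleOf_apply_of_not_sameCycle h1]

theorem invCycleAt_pow_apply_of_sameCycle {v i : V} {σ : Equiv.Perm V} (h : σ.SameCycle v i)
    (n : ℕ) : (invCycleAt v σ ^ n) i = (σ⁻¹ ^ n) i := by
  induction n with
  | zero => simp
  | succ n ih =>
    rw [pow_succ', pow_succ', mul_apply, mul_apply, ih, invCycleAt_apply_of_sameCycle]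
    exact sameCycle_inv.1 (sameCycle_pow_right.2 h.inv)

theorem invCycleAt_pow_apply_of_not_sameCycle {v i : V} {σ : Equiv.Perm V}
    (h : ¬ σ.SameCycle v i) (n : ℕ) : (invCycleAt v σ ^ n) i = (σ ^ n) i := by
  induction n with
  | zero => simp
  | succ n ih =>
    rw [pow_succ', pow_succ', mul_apply, mul_apply, ih, invCycleAt_apply_of_not_sameCycle]
    rwa [sameCycle_pow_right]

theorem sameCycle_invCycleAt {v i j : V} {σ : Equiv.Perm V} :
    (invCycleAt v σ).SameCycle i j ↔ σ.SameCycle i j := by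
  by_cases h : σ.SameCycle v i
  · rw [← sameCycle_inv (f := σ), sameCycle_iff_exists_natPow, sameCycle_iff_exists_natPow]
    simp only [invCycleAt_pow_apply_of_sameCycle h]
  · rw [sameCycle_iff_exists_natPow, sameCycle_iff_exists_natPow]
    simp only [invCycleAt_pow_apply_of_not_sameCycle h]

theorem invCycleAt_involutive (v : V) : Function.Involutive (invCycleAt v) := by
  intro σ
  ext i
  by_cases h : σ.SameCycle v i
  · rw [invCycleAt_apply_of_sameCycle (sameCycle_invCycleAt.2 h), inv_eq_iff_eq,
      invCycleAt_apply_of_sameCycle (sameCycle_apply_right.2 h)]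
    exact (σ.symm_apply_apply i).symm
  · rw [invCycleAt_apply_of_not_sameCycle (fun h' => h (sameCycle_invCycleAt.1 h')),
      invCycleAt_apply_of_not_sameCycle h]

end Equiv.Perm

namespace Matrix

open Equiv.Perm

variable {V R : Type*} [Fintype V] [DecidableEq V] [CommRing R]

open Classical in
/-- The Leibniz term of `σ` in which the cycles meeting `S` are weighted by `M'` and the other
cycles by `M`. -/
noncomputable def mixedLeibnizTerm (M M' : Matrix V V R) (S : Finset V) (σ : Equiv.Perm V) : R :=
  ∏ i, if ∃ s ∈ S, σ.SameCycle s i then M' (σ i) i else M (σ i) i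

open Classical in
theorem mixedLeibnizTerm_add_invCycleAt {M M' : Matrix V V R}
    (h : ∀ (σ : Equiv.Perm V) (v : V),
      ∏ i with σ.SameCycle v i, M (σ i) i + ∏ i with σ.SameCycle v i, M i (σ i) =
        ∏ i with σ.SameCycle v i, M' (σ i) i + ∏ i with σ.SameCycle v i, M' i (σ i))
    (S : Finset V) (v : V) (σ : Equiv.Perm V) :
    mixedLeibnizTerm M M' (insert v S) σ + mixedLeibnizTerm M M' (insert v S) (invCycleAt v σ) =
      mixedLeibnizTerm M M' S σ + mixedLeibnizTerm M M' S (invCycleAt v σ) := by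
  by_cases hS : ∃ s ∈ S, σ.SameCycle s v
  · obtain ⟨s, hs, hsv⟩ := hS
    have key : ∀ i, (∃ s ∈ insert v S, σ.SameCycle s i) ↔ ∃ s ∈ S, σ.SameCycle s i := by
      intro i
      constructor
      · rintro ⟨t, ht, hti⟩
        rcases Finset.mem_insert.1 ht with rfl | ht
        · exact ⟨s, hs, hsv.trans hti⟩
        · exact ⟨t, ht, hti⟩
      · rintro ⟨t, ht, hti⟩
        exact ⟨t, Finset.mem_insert_of_mem ht, hti⟩
    simp only [mixedLeibnizTerm, sameCycle_invCycleAt, key]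
  · have hcyc : ∀ A : Matrix V V R,
        ∏ i with σ.SameCycle v i, A (σ⁻¹ i) i = ∏ i with σ.SameCycle v i, A i (σ i) := by
      intro A
      refine (Finset.prod_equiv σ (fun i => ?_) fun i _ => ?_).symm
      · simp [sameCycle_apply_right]
      · simp
    have hsplit : ∀ (T : Finset V) (τ : Equiv.Perm V), mixedLeibnizTerm M M' T τ =
        (∏ i with σ.SameCycle v i, if ∃ s ∈ T, τ.SameCycle s i then M' (τ i) i else M (τ i) i) *
        ∏ i with ¬ σ.SameCycle v i,
          if ∃ s ∈ T, τ.SameCycle s i then M' (τ i) i else M (τ i) i :=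
      fun T τ => (Finset.prod_filter_mul_prod_filter_not _ _ _).symm
    have hin : ∀ i, σ.SameCycle v i → ∃ s ∈ insert v S, σ.SameCycle s i :=
      fun i hi => ⟨v, Finset.mem_insert_self _ _, hi⟩
    have hnin : ∀ i, σ.SameCycle v i → ¬ ∃ s ∈ S, σ.SameCycle s i :=
      fun i hi ⟨s, hs, hsi⟩ => hS ⟨s, hs, hsi.trans hi.symm⟩
    have hout : ∀ i, ¬ σ.SameCycle v i →
        ((∃ s ∈ insert v S, σ.SameCycle s i) ↔ ∃ s ∈ S, σ.SameCycle s i) := by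
      intro i hi
      simp [hi]
    have e1 : ∀ (A : Matrix V V R), (∏ i with σ.SameCycle v i, A (invCycleAt v σ i) i) =
        ∏ i with σ.SameCycle v i, A i (σ i) := by
      intro A
      rw [← hcyc]
      refine Finset.prod_congr rfl fun i hi => ?_
      rw [invCycleAt_apply_of_sameCycle (Finset.mem_filter.1 hi).2]
    have f1 : ∀ τ : Equiv.Perm V, (∏ i with σ.SameCycle v i,
          if ∃ s ∈ insert v S, σ.SameCycle s i then M' (τ i) i else M (τ i) i) =
        ∏ i with σ.SameCycle v i, M' (τ i) i := fun τ =>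
      Finset.prod_congr rfl fun i hi => if_pos (hin i (Finset.mem_filter.1 hi).2)
    have f2 : ∀ τ : Equiv.Perm V, (∏ i with σ.SameCycle v i,
          if ∃ s ∈ S, σ.SameCycle s i then M' (τ i) i else M (τ i) i) =
        ∏ i with σ.SameCycle v i, M (τ i) i := fun τ =>
      Finset.prod_congr rfl fun i hi => if_neg (hnin i (Finset.mem_filter.1 hi).2)
    have f3 : ∀ T : Finset V, (∏ i with ¬ σ.SameCycle v i,
          if ∃ s ∈ T, σ.SameCycle s i then M' (invCycleAt v σ i) i
            else M (invCycleAt v σ i) i) =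
        ∏ i with ¬ σ.SameCycle v i,
          if ∃ s ∈ T, σ.SameCycle s i then M' (σ i) i else M (σ i) i := fun T =>
      Finset.prod_congr rfl fun i hi => by
        rw [invCycleAt_apply_of_not_sameCycle (Finset.mem_filter.1 hi).2]
    have f4 : (∏ i with ¬ σ.SameCycle v i,
          if ∃ s ∈ insert v S, σ.SameCycle s i then M' (σ i) i else M (σ i) i) =
        ∏ i with ¬ σ.SameCycle v i,
          if ∃ s ∈ S, σ.SameCycle s i then M' (σ i) i else M (σ i) i :=
      Finset.prod_congr rfl fun i hi => by
        simp only [hout i (Finset.mem_filter.1 hi).2]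
    simp only [hsplit, sameCycle_invCycleAt]
    rw [f1, f1, f2, f2, f3, f3, f4, e1, e1, ← add_mul, ← add_mul, h]

open Classical in
/-- The determinant of a matrix only depends on the sums of the weights of each directed cycle and
of its reverse. -/
theorem det_eq_det_of_cycle_weight_add_reverse [IsDomain R] [CharZero R] {M M' : Matrix V V R}
    (h : ∀ (σ : Equiv.Perm V) (v : V),
      ∏ i with σ.SameCycle v i, M (σ i) i + ∏ i with σ.SameCycle v i, M i (σ i) =
        ∏ i with σ.SameCycle v i, M' (σ i) i + ∏ i with σ.SameCycle v i, M' i (σ i)) :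
    M.det = M'.det := by
  have key : ∀ S : Finset V, ∑ σ : Equiv.Perm V, ((sign σ : ℤ) : R) * mixedLeibnizTerm M M' S σ =
      M.det := by
    intro S
    induction S using Finset.induction_on with
    | empty => simp [det_apply', mixedLeibnizTerm]
    | insert v S _ ih =>
      rw [← ih]
      have hsum : ∀ F : Equiv.Perm V → R, 2 * ∑ σ : Equiv.Perm V, ((sign σ : ℤ) : R) * F σ =
          ∑ σ : Equiv.Perm V, ((sign σ : ℤ) : R) * (F σ + F (invCycleAt v σ)) := by
        intro F
        simp only [mul_add, Finset.sum_add_distrib]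
        rw [two_mul, ← Equiv.sum_comp (invCycleAt_involutive v).toPerm
          (fun σ => ((sign σ : ℤ) : R) * F σ)]
        simp [sign_invCycleAt]
      apply mul_left_cancel₀ (two_ne_zero (α := R))
      rw [hsum, hsum]
      simp only [mixedLeibnizTerm_add_invCycleAt h]
  rw [← key Finset.univ, det_apply']
  refine Finset.sum_congr rfl fun σ _ => ?_
  rw [mixedLeibnizTerm]
  congr 1
  refine Finset.prod_congr rfl fun i _ => if_pos ⟨i, Finset.mem_univ _, SameCycle.refl _ _⟩

end Matrix

namespace SimpleGraph

theorem exists_walk_of_adj_succ {V : Type*} (G : SimpleGraph V) (n : ℕ) (f : ℕ → V)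
    (h : ∀ j < n, G.Adj (f j) (f (j + 1))) :
    ∃ p : G.Walk (f 0) (f n), p.support = (List.range (n + 1)).map f ∧
      p.darts.map Dart.toProd = (List.range n).map fun j => (f j, f (j + 1)) := by
  induction n generalizing f with
  | zero => exact ⟨Walk.nil, by simp, by simp⟩
  | succ n ih =>
    obtain ⟨p, hs, hd⟩ := ih (fun j => f (j + 1)) fun j hj => h (j + 1) (by lia)
    refine ⟨Walk.cons (h 0 (by lia)) p, ?_, ?_⟩
    · rw [Walk.support_cons, hs, List.range_succ_eq_map (n := n + 1)]
      simp [Function.comp_def]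
    · rw [Walk.darts_cons, List.map_cons, hd, List.range_succ_eq_map (n := n)]
      simp [Function.comp_def]

end SimpleGraph

namespace Equiv.Perm

variable {V : Type*}

theorem minimalPeriod_pos [Finite V] (σ : Equiv.Perm V) (v : V) : 0 < Function.minimalPeriod σ v :=
  Function.minimalPeriod_pos_of_mem_periodicPts (σ.injective.mem_periodicPts v)

theorem prod_sameCycle_eq_prod_range [Fintype V] {R : Type*} [CommMonoid R] (σ : Equiv.Perm V)
    (v : V) [DecidablePred (σ.SameCycle v)] (F : V → R) :
    ∏ i with σ.SameCycle v i, F i =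
      ∏ j ∈ Finset.range (Function.minimalPeriod σ v), F (σ^[j] v) := by
  refine (Finset.prod_bij (fun j _ => σ^[j] v) ?_ ?_ ?_ ?_).symm
  · intro j _
    rw [Finset.mem_filter, sameCycle_iff_exists_natPow]
    exact ⟨Finset.mem_univ _, j, by rw [iterate_eq_pow]⟩
  · intro a ha b hb hab
    exact Function.iterate_injOn_Iio_minimalPeriod (by simpa using ha) (by simpa using hb) hab
  · intro i hi
    obtain ⟨n, hn⟩ := sameCycle_iff_exists_natPow.1 (Finset.mem_filter.1 hi).2
    refine ⟨n % Function.minimalPeriod σ v, ?_, ?_⟩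
    · exact Finset.mem_range.2 (Nat.mod_lt _ (minimalPeriod_pos σ v))
    · rw [Function.iterate_mod_minimalPeriod_eq, iterate_eq_pow, hn]
  · intro j _
    rfl

/-- An orbit of length at least three whose consecutive points are adjacent is a cycle of the
graph. -/
theorem exists_isCycle_of_adj_apply (σ : Equiv.Perm V) (v : V) (G : SimpleGraph V)
    (hn : 3 ≤ Function.minimalPeriod σ v) (hG : ∀ j, G.Adj (σ^[j] v) (σ^[j + 1] v)) :
    ∃ p : G.Walk v v, p.IsCycle ∧ p.darts.map SimpleGraph.Dart.toProd =
      (List.range (Function.minimalPeriod σ v)).map fun j => (σ^[j] v, σ^[j + 1] v) := by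
  have hv : σ^[Function.minimalPeriod σ v] v = v := Function.iterate_minimalPeriod
  obtain ⟨p, hs, hd⟩ : ∃ p : G.Walk v v,
      p.support = (List.range (Function.minimalPeriod σ v + 1)).map (fun j => σ^[j] v) ∧
      p.darts.map SimpleGraph.Dart.toProd =
        (List.range (Function.minimalPeriod σ v)).map fun j => (σ^[j] v, σ^[j + 1] v) := by
    have h : ∃ p : G.Walk v (σ^[Function.minimalPeriod σ v] v), _ :=
      G.exists_walk_of_adj_succ (Function.minimalPeriod σ v) (fun j => σ^[j] v) fun j _ => hG j
    rwa [hv] at h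
  have hlen : p.length = Function.minimalPeriod σ v := by
    simpa [SimpleGraph.Walk.length_support] using congrArg List.length hs
  have hnil : ¬ p.Nil := by
    rw [SimpleGraph.Walk.not_nil_iff_lt_length]
    lia
  have htail : p.tail.IsPath := by
    rw [SimpleGraph.Walk.isPath_def, SimpleGraph.Walk.support_tail_of_not_nil _ hnil,
      hs, List.range_succ_eq_map, List.map_cons, List.tail_cons,
      List.map_map]
    refine List.Nodup.map_on ?_ List.nodup_range
    intro a ha b hb hab
    refine Function.iterate_injOn_Iio_minimalPeriod (by simpa using ha) (by simpa using hb) ?_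
    apply σ.injective
    simpa [Function.iterate_succ_apply'] using hab
  exact ⟨p, SimpleGraph.Walk.isCycle_iff_isPath_tail_and_le_length.2 ⟨htail, hlen ▸ hn⟩, hd⟩

end Equiv.Perm

theorem norm_eq_one_of_mem_of_ne_zero {k : ℕ} {z : ℂ}
    (hz : z ∈ ({0, 1, Complex.exp (2 * (Real.pi : ℂ) * Complex.I / (k : ℂ)),
      (starRingEnd ℂ) (Complex.exp (2 * (Real.pi : ℂ) * Complex.I / (k : ℂ)))} : Set ℂ))
    (h0 : z ≠ 0) : ‖z‖ = 1 := by
  have hω : ‖Complex.exp (2 * (Real.pi : ℂ) * Complex.I / (k : ℂ))‖ = 1 := by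
    have : 2 * (Real.pi : ℂ) * Complex.I / (k : ℂ) = ((2 * Real.pi / k : ℝ) : ℂ) * Complex.I := by
      push_cast
      ring
    rw [this, Complex.norm_exp_ofReal_mul_I]
  rcases hz with rfl | rfl | rfl | rfl
  · exact absurd rfl h0
  · simp
  · exact hω
  · rw [RCLike.norm_conj, hω]

namespace Matrix

variable {V : Type*} [Fintype V] [DecidableEq V]

open Classical in
theorem charmatrix_cycle_weight_add_reverse {H : Matrix V V ℂ} (hH : H.IsHermitian)
    {σ : Equiv.Perm V} {v : V} (hv : σ v ≠ v) :
    ∏ i with σ.SameCycle v i, H.charmatrix (σ i) i +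
        ∏ i with σ.SameCycle v i, H.charmatrix i (σ i) =
      (-1) ^ (Finset.univ.filter (σ.SameCycle v)).card *
        Polynomial.C ((2 * (∏ i with σ.SameCycle v i, H i (σ i)).re : ℝ) : ℂ) := by
  have hne : ∀ i ∈ Finset.univ.filter (σ.SameCycle v), σ i ≠ i := fun i hi h =>
    hv ((Finset.mem_filter.1 hi).2.apply_eq_self_iff.2 h)
  have h1 : ∏ i with σ.SameCycle v i, H.charmatrix (σ i) i =
      (-1) ^ (Finset.univ.filter (σ.SameCycle v)).card *
        Polynomial.C ((starRingEnd ℂ) (∏ i with σ.SameCycle v i, H i (σ i))) := by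
    rw [map_prod, map_prod, ← Finset.prod_const, ← Finset.prod_mul_distrib]
    refine Finset.prod_congr rfl fun i hi => ?_
    rw [charmatrix_apply_ne _ _ _ (hne i hi), ← hH.apply (σ i) i, neg_one_mul]
    rfl
  have h2 : ∏ i with σ.SameCycle v i, H.charmatrix i (σ i) =
      (-1) ^ (Finset.univ.filter (σ.SameCycle v)).card *
        Polynomial.C (∏ i with σ.SameCycle v i, H i (σ i)) := by
    rw [map_prod, ← Finset.prod_const, ← Finset.prod_mul_distrib]
    refine Finset.prod_congr rfl fun i hi => ?_
    rw [charmatrix_apply_ne _ _ _ (hne i hi).symm, neg_one_mul]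
  rw [h1, h2, ← mul_add, ← map_add, add_comm ((starRingEnd ℂ) _), Complex.add_conj]

end Matrix


open Matrix

/-- If two mixed graphs `H`, `H'` with the same underlying graph `G` are such that for every
cycle of `G` the real parts of the weights of the cycle in `H` and in `H'` agree, then
`H` and `H'` are cospectral. -/
theorem stmt_1 {V : Type*} [Fintype V] [DecidableEq V] [Nonempty V]
    (k : ℕ) (hk : 3 ≤ k) (ω : ℂ)
    (hω : ω = Complex.exp (2 * (Real.pi : ℂ) * Complex.I / (k : ℂ)))
    (H H' : Matrix V V ℂ)
    (hherm : H.IsHermitian) (hdiag : ∀ v, H v v = 0)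
    (hent : ∀ u v, H u v ∈ ({0, 1, ω, (starRingEnd ℂ) ω} : Set ℂ))
    (hherm' : H'.IsHermitian) (hdiag' : ∀ v, H' v v = 0)
    (hent' : ∀ u v, H' u v ∈ ({0, 1, ω, (starRingEnd ℂ) ω} : Set ℂ))
    (hsame : ∀ u v, H u v ≠ 0 ↔ H' u v ≠ 0)
    (G : SimpleGraph V) (hadj : ∀ u v, G.Adj u v ↔ u ≠ v ∧ H u v ≠ 0)
    (hcyc : ∀ (v : V) (p : G.Walk v v), p.IsCycle →
      ((p.darts.map fun d => H d.toProd.1 d.toProd.2).prod).re =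
        ((p.darts.map fun d => H' d.toProd.1 d.toProd.2).prod).re) :
    H.charpoly = H'.charpoly := by
  have hnorm : ∀ u v, H u v ≠ 0 → ‖H u v‖ = 1 := fun u v h =>
    norm_eq_one_of_mem_of_ne_zero (hω ▸ hent u v) h
  have hnorm' : ∀ u v, H' u v ≠ 0 → ‖H' u v‖ = 1 := fun u v h =>
    norm_eq_one_of_mem_of_ne_zero (hω ▸ hent' u v) h
  classical
  refine Matrix.det_eq_det_of_cycle_weight_add_reverse fun σ v => ?_
  by_cases hv : σ v = v
  · have hfix : ∀ i ∈ Finset.univ.filter (σ.SameCycle v), i = v := fun i hi =>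
      ((Finset.mem_filter.1 hi).2.eq_of_left hv).symm
    congr 1 <;> refine Finset.prod_congr rfl fun i hi => ?_ <;>
      rw [hfix i hi, hv, Matrix.charmatrix_apply_eq, Matrix.charmatrix_apply_eq, hdiag, hdiag']
  suffices hre : (∏ i with σ.SameCycle v i, H i (σ i)).re =
      (∏ i with σ.SameCycle v i, H' i (σ i)).re by
    rw [Matrix.charmatrix_cycle_weight_add_reverse hherm hv,
      Matrix.charmatrix_cycle_weight_add_reverse hherm' hv, hre]
  by_cases h0 : ∃ i, σ.SameCycle v i ∧ H i (σ i) = 0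
  · obtain ⟨i, hi, hi0⟩ := h0
    have hi0' : H' i (σ i) = 0 := by
      by_contra h
      exact (hsame _ _).2 h hi0
    have hmem : i ∈ Finset.univ.filter (σ.SameCycle v) := by simpa using hi
    rw [Finset.prod_eq_zero hmem hi0, Finset.prod_eq_zero hmem hi0']
  push Not at h0
  have hsc : ∀ j, σ.SameCycle v (σ^[j] v) := fun j => by
    rw [Equiv.Perm.iterate_eq_pow, Equiv.Perm.sameCycle_pow_right]
  have hstep : ∀ j, H (σ^[j] v) (σ^[j + 1] v) ≠ 0 := fun j => by
    rw [Function.iterate_succ_apply']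
    exact h0 _ (hsc j)
  rw [Equiv.Perm.prod_sameCycle_eq_prod_range, Equiv.Perm.prod_sameCycle_eq_prod_range]
  simp only [← Function.iterate_succ_apply' (f := σ)]
  have hpos := Equiv.Perm.minimalPeriod_pos σ v
  have hone : Function.minimalPeriod σ v ≠ 1 := fun h =>
    hv (Function.minimalPeriod_eq_one_iff_isFixedPt.1 h)
  by_cases htwo : Function.minimalPeriod σ v = 2
  · have hσ : σ^[2] v = v := htwo ▸ Function.iterate_minimalPeriod
    have hpair : ∀ A : Matrix V V ℂ, A.IsHermitian → ‖A v (σ v)‖ = 1 →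
        ∏ j ∈ Finset.range 2, A (σ^[j] v) (σ^[j + 1] v) = 1 := by
      intro A hA hA1
      rw [Finset.prod_range_succ, Finset.prod_range_one, hσ]
      change A v (σ v) * A (σ v) v = 1
      rw [← hA.apply (σ v) v]
      change A v (σ v) * (starRingEnd ℂ) (A v (σ v)) = 1
      rw [Complex.mul_conj, Complex.normSq_eq_norm_sq, hA1]
      simp
    have hH := hstep 0
    rw [htwo, hpair H hherm (hnorm _ _ hH),
      hpair H' hherm' (hnorm' _ _ ((hsame _ _).1 hH))]
  · have hG : ∀ j, G.Adj (σ^[j] v) (σ^[j + 1] v) := fun j => by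
      rw [hadj]
      refine ⟨fun h => hstep j ?_, hstep j⟩
      rw [← h, hdiag]
    obtain ⟨p, hp, hd⟩ := Equiv.Perm.exists_isCycle_of_adj_apply σ v G (by lia) hG
    have hw : ∀ A : Matrix V V ℂ, (p.darts.map fun d => A d.toProd.1 d.toProd.2).prod =
        ∏ j ∈ Finset.range (Function.minimalPeriod σ v), A (σ^[j] v) (σ^[j + 1] v) := by
      intro A
      have h := congrArg (fun l => (l.map fun q : V × V => A q.1 q.2).prod) hd
      simp only [List.map_map] at h
      rw [← List.toFinset_range, List.prod_toFinset _ List.nodup_range]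
      exact h
    rw [← hw, ← hw]
    exact hcyc v p hp
end

section
/- Let k ≥ 3 be an integer, ω = exp(2πi/k), and let H be the Hermitian adjacency matrix of a mixed graph on a finite vertex set V. Suppose f : V → ZMod k is an admissible partition, i.e. for all u, v ∈ V: if H u v = 1 then f v − f u ∈ {0, 1, −1} in ZMod k, and if H u v = ω then f u − f v ∈ {0, 1, 2} in ZMod k. Define the matrix H' by H' u v = ω^(f v − f u) · H u v (where ω raised to an element of ZMod k is defined via any integer lift, which is well defined since ω^k = 1). Then (1) H' is again the Hermitian adjacency matrix of a mixed graph: H' is Hermitian, has zero diagonal, and all its entries lie in {0, 1, ω, conj ω}; (2) H' u v ≠ 0 iff H u v ≠ 0, so H' has the same underlying graph as H; and (3) H' and H are cospectral, i.e. they have the same characteristic polynomial. -/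
open Matrix

/-- Scaling the entries of a matrix by `a u * b v` with `b v * a v = 1` is a conjugation by a
diagonal matrix, so it preserves the characteristic polynomial. -/
theorem Matrix.charpoly_eq_of_diagonal_conj {V R : Type*} [Fintype V] [DecidableEq V] [CommRing R]
    {M N : Matrix V V R} {a b : V → R} (hab : ∀ v, b v * a v = 1)
    (hN : ∀ u v, N u v = a u * M u v * b v) : N.charpoly = M.charpoly := by
  have hconj : N = (diagonal a * M) * diagonal b := by
    ext u v
    simp [hN]
  have hdiag : diagonal b * diagonal a = 1 := by
    simp [diagonal_mul_diagonal, hab]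
  rw [hconj, charpoly_mul_comm, ← Matrix.mul_assoc, hdiag, Matrix.one_mul]

/-- Three-way switching: given an admissible partition `f : V → ZMod k` of a mixed graph `H`,
the switched matrix `H' u v = ω^(f v - f u) * H u v` is again a Hermitian adjacency matrix of a
mixed graph with the same underlying graph, and is cospectral with `H`. -/
theorem stmt_2 {V : Type*} [Fintype V] [DecidableEq V] [Nonempty V]
    (k : ℕ) (hk : 3 ≤ k) (ω : ℂ)
    (hω : ω = Complex.exp (2 * (Real.pi : ℂ) * Complex.I / (k : ℂ)))
    (H : Matrix V V ℂ) (hherm : H.IsHermitian) (hdiag : ∀ v, H v v = 0)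
    (hent : ∀ u v, H u v ∈ ({0, 1, ω, (starRingEnd ℂ) ω} : Set ℂ))
    (f : V → ZMod k)
    (hf1 : ∀ u v, H u v = 1 → f v - f u ∈ ({0, 1, -1} : Set (ZMod k)))
    (hfω : ∀ u v, H u v = ω → f u - f v ∈ ({0, 1, 2} : Set (ZMod k)))
    (H' : Matrix V V ℂ)
    (hH' : ∀ u v, H' u v = ω ^ (f v - f u).val * H u v) :
    H'.IsHermitian ∧ (∀ v, H' v v = 0) ∧
      (∀ u v, H' u v ∈ ({0, 1, ω, (starRingEnd ℂ) ω} : Set ℂ)) ∧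
      (∀ u v, H' u v ≠ 0 ↔ H u v ≠ 0) ∧
      H'.charpoly = H.charpoly := by
  have : NeZero k := ⟨by omega⟩
  have hω1 : ω ^ k = 1 := hω ▸ (Complex.isPrimitiveRoot_exp k (NeZero.ne k)).pow_eq_one
  have hinv : ω⁻¹ = (starRingEnd ℂ) ω :=
    Complex.inv_eq_conj (Complex.norm_eq_one_of_pow_eq_one hω1 (NeZero.ne k))
  have hω0 : ω ≠ 0 := hω ▸ Complex.exp_ne_zero _
  have hcω : (starRingEnd ℂ) ω * ω = 1 := by rw [← hinv, inv_mul_cancel₀ hω0]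
  obtain ⟨χ, hχ⟩ : ∃ χ : AddChar (ZMod k) ℂ, ∀ a, ω ^ a.val = χ a :=
    ⟨AddChar.zmodChar k hω1, fun a => (AddChar.zmodChar_apply hω1 a).symm⟩
  have hχ1 : χ 1 = ω := by
    have : Fact (1 < k) := ⟨by omega⟩
    rw [← hχ, ZMod.val_one, pow_one]
  have hχneg (a : ZMod k) : χ (-a) = (starRingEnd ℂ) (χ a) := by
    rw [AddChar.map_neg_eq_inv, ← hχ, map_pow, ← hinv, inv_pow]
  have hχ2 : χ 2 = ω * ω := by rw [← one_add_one_eq_two, AddChar.map_add_eq_mul, hχ1]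
  have hχmul (a : ZMod k) : χ a * χ (-a) = 1 := by
    rw [← AddChar.map_add_eq_mul, add_neg_cancel, AddChar.map_zero_eq_one]
  have hχ0 (a : ZMod k) : χ a ≠ 0 := left_ne_zero_of_mul_eq_one (hχmul a)
  simp only [hχ] at hH'
  have hherm' : H'.IsHermitian := by
    ext u v
    rw [conjTranspose_apply, hH', hH', star_mul', hherm.apply, ← starRingEnd_apply, ← hχneg,
      neg_sub]
  have hentω (u v : V) (h : H u v = ω) :
      H' u v ∈ ({0, 1, ω, (starRingEnd ℂ) ω} : Set ℂ) := by
    rw [hH', h, ← neg_sub, hχneg]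
    rcases hfω u v h with h | h | h <;> rw [h]
    · simp
    · simp [hχ1, hcω]
    · simp [hχ2, mul_assoc, hcω]
  refine ⟨hherm', fun v => by simp [hH', hdiag], fun u v => ?_, fun u v => by simp [hH', hχ0],
    Matrix.charpoly_eq_of_diagonal_conj (a := fun v => χ (-f v)) (b := fun v => χ (f v))
      (fun v => hχmul _) fun u v => ?_⟩
  · rcases hent u v with h | h | h | h
    · simp [hH', h]
    · rw [hH', h]
      rcases hf1 u v h with h | h | h <;> rw [h]
      · simp
      · simp [hχ1]
      · simp [hχneg, hχ1]
    · exact hentω u v h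
    · have hvu : H v u = ω := by
        rw [← hherm.apply v u, h, ← starRingEnd_apply, Complex.conj_conj]
      rw [← hherm'.apply u v]
      rcases hentω v u hvu with h | h | h | h <;> rw [h] <;> simp
  · rw [hH', sub_eq_add_neg, AddChar.map_add_eq_mul]
    ring
end

section
/- Let k ≥ 3 be an integer, ω = exp(2πi/k), and let H be the Hermitian adjacency matrix of a mixed graph on a finite vertex set V. Let S ⊆ V be a set of vertices such that there is no pair u ∈ S, v ∉ S with H u v = ω (i.e. no arc from S to its complement). Define H' by: H' u v = conj ω · H u v if u ∉ S and v ∈ S; H' u v = ω · H u v if u ∈ S and v ∉ S; and H' u v = H u v otherwise. Then H' is again the Hermitian adjacency matrix of a mixed graph (H' is Hermitian, has zero diagonal, and all entries lie in {0, 1, ω, conj ω}), H' has the same underlying graph as H, and H' and H are cospectral, i.e. they have the same characteristic polynomial. -/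
open Matrix

/-- Conjugating a matrix by a diagonal matrix with invertible entries keeps its characteristic
polynomial. -/
theorem Matrix.charpoly_eq_of_diagonal_conj_s3 {V R : Type*} [Fintype V] [DecidableEq V] [CommRing R]
    {A B : Matrix V V R} (d e : V → R) (hed : ∀ v, e v * d v = 1)
    (hB : ∀ u v, B u v = d u * A u v * e v) : B.charpoly = A.charpoly := by
  have hB' : B = diagonal d * (A * diagonal e) := by
    ext u v
    rw [diagonal_mul, mul_diagonal, hB, mul_assoc]
  rw [hB', charpoly_mul_comm, mul_assoc, diagonal_mul_diagonal]
  simp [hed]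

/-- Two-way switching: if `S ⊆ V` is such that there is no arc from `S` to its complement,
then the matrix `H'` obtained by multiplying entries from outside `S` into `S` by `conj ω` and
entries from `S` to outside `S` by `ω` is again a Hermitian adjacency matrix of a mixed graph
with the same underlying graph, and is cospectral with `H`. -/
theorem stmt_3 {V : Type*} [Fintype V] [DecidableEq V] [Nonempty V]
    (k : ℕ) (hk : 3 ≤ k) (ω : ℂ)
    (hω : ω = Complex.exp (2 * (Real.pi : ℂ) * Complex.I / (k : ℂ)))
    (H : Matrix V V ℂ) (hherm : H.IsHermitian) (hdiag : ∀ v, H v v = 0)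
    (hent : ∀ u v, H u v ∈ ({0, 1, ω, (starRingEnd ℂ) ω} : Set ℂ))
    (S : Set V)
    (hS : ∀ u ∈ S, ∀ v, v ∉ S → H u v ≠ ω)
    (H' : Matrix V V ℂ)
    (hH'in : ∀ u v, u ∉ S → v ∈ S → H' u v = (starRingEnd ℂ) ω * H u v)
    (hH'out : ∀ u v, u ∈ S → v ∉ S → H' u v = ω * H u v)
    (hH'eq : ∀ u v, (u ∈ S ↔ v ∈ S) → H' u v = H u v) :
    H'.IsHermitian ∧ (∀ v, H' v v = 0) ∧
      (∀ u v, H' u v ∈ ({0, 1, ω, (starRingEnd ℂ) ω} : Set ℂ)) ∧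
      (∀ u v, H' u v ≠ 0 ↔ H u v ≠ 0) ∧
      H'.charpoly = H.charpoly := by
  have hω1 : (starRingEnd ℂ) ω * ω = 1 := by
    have hexp : ω = Complex.exp ((2 * Real.pi / k : ℝ) * Complex.I) := by
      rw [hω]
      congr 1
      push_cast
      ring
    rw [Complex.conj_mul', hexp, Complex.norm_exp_ofReal_mul_I]
    norm_num
  have hω0 : ω ≠ 0 := right_ne_zero_of_mul_eq_one hω1
  have hω0' : (starRingEnd ℂ) ω ≠ 0 := left_ne_zero_of_mul_eq_one hω1
  have hH : ∀ u v, (starRingEnd ℂ) (H v u) = H u v := fun u v => hherm.apply u v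
  have hherm' : ∀ u v, (starRingEnd ℂ) (H' v u) = H' u v := by
    intro u v
    by_cases hu : u ∈ S <;> by_cases hv : v ∈ S
    · rw [hH'eq u v (by tauto), hH'eq v u (by tauto), hH]
    · rw [hH'out u v hu hv, hH'in v u hv hu, map_mul, hH, Complex.conj_conj]
    · rw [hH'in u v hu hv, hH'out v u hv hu, map_mul, hH]
    · rw [hH'eq u v (by tauto), hH'eq v u (by tauto), hH]
  have hout : ∀ u v, u ∈ S → v ∉ S → H' u v = 0 ∨ H' u v = 1 ∨ H' u v = ω := by
    intro u v hu hv
    rw [hH'out u v hu hv]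
    rcases hent u v with h | h | h | h
    · simp [h]
    · simp [h]
    · exact absurd h (hS u hu v hv)
    · rw [h, mul_comm, hω1]
      simp
  refine ⟨IsHermitian.ext hherm', fun v => by rw [hH'eq v v Iff.rfl, hdiag], ?_, ?_, ?_⟩
  · intro u v
    by_cases hu : u ∈ S <;> by_cases hv : v ∈ S
    · rw [hH'eq u v (by tauto)]
      exact hent u v
    · rcases hout u v hu hv with h | h | h <;> simp [h]
    · rw [← hherm' u v]
      rcases hout v u hv hu with h | h | h <;> simp [h]
    · rw [hH'eq u v (by tauto)]
      exact hent u v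
  · intro u v
    by_cases hu : u ∈ S <;> by_cases hv : v ∈ S
    · rw [hH'eq u v (by tauto)]
    · simp [hH'out u v hu hv, hω0]
    · rw [hH'in u v hu hv, mul_ne_zero_iff, and_iff_right hω0']
    · rw [hH'eq u v (by tauto)]
  · classical
    refine charpoly_eq_of_diagonal_conj_s3 (fun v => if v ∈ S then ω else 1)
      (fun v => if v ∈ S then (starRingEnd ℂ) ω else 1) (fun v => ?_) (fun u v => ?_)
    · by_cases hv : v ∈ S <;> simp only [hv, if_true, if_false, hω1, mul_one]
    · by_cases hu : u ∈ S <;> by_cases hv : v ∈ S <;>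
        simp only [hu, hv, if_true, if_false, mul_one, one_mul]
      · rw [hH'eq u v (by tauto)]
        linear_combination -H u v * hω1
      · exact hH'out u v hu hv
      · rw [hH'in u v hu hv, mul_comm]
      · exact hH'eq u v (by tauto)
end

section
/- Let k ≥ 3 be an integer, ω = exp(2πi/k), G a connected simple graph on a finite nonempty vertex set V with 0/1 adjacency matrix A (viewed as a complex matrix), and let H be the Hermitian adjacency matrix of a mixed graph on V whose underlying graph is a spanning subgraph of G (i.e. H u v ≠ 0 implies u and v are adjacent in G). If the largest eigenvalue of H equals the largest eigenvalue of A, then: (1) the underlying graph of H is exactly G (H u v ≠ 0 iff u, v adjacent in G), and (2) there exists f : V → ZMod k such that for all u, v: if H u v = 1 then f u = f v, and if H u v = ω then f u − f v = 1 in ZMod k. -/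
open Matrix

section

open scoped ComplexOrder

/-- A Hermitian matrix whose eigenvalues are at most `r` is bounded above by `r • 1`. -/
lemma posSemidef_smul_one_sub {V : Type*} [Fintype V] [DecidableEq V] {A : Matrix V V ℂ}
    (hA : A.IsHermitian) {r : ℝ} (hr : ∀ i, hA.eigenvalues i ≤ r) :
    ((r : ℂ) • (1 : Matrix V V ℂ) - A).PosSemidef := by
  rw [posSemidef_iff_isHermitian_and_spectrum_nonneg]
  refine ⟨(isHermitian_one.smul (Complex.conj_ofReal r)).sub hA, fun a ha ↦ ?_⟩
  rw [← Algebra.algebraMap_eq_smul_one, ← spectrum.singleton_sub_eq,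
    hA.spectrum_eq_image_range] at ha
  obtain ⟨_, rfl, _, ⟨_, ⟨i, rfl⟩, rfl⟩, rfl⟩ := ha
  have := hr i
  simpa using this

/-- If `H` is dominated entrywise by a nonnegative Hermitian matrix `A` bounded above by `r • 1`,
and `x` is an eigenvector of `H` for `r`, then the vector of moduli of `x` is an eigenvector of `A`
for `r`, and every term of the quadratic form of `H` at `x` attains its bound. -/
lemma eigenvector_norm_of_dominated {V : Type*} [Fintype V] [DecidableEq V]
    {A H : Matrix V V ℂ} {r : ℝ} (hB : ((r : ℂ) • (1 : Matrix V V ℂ) - A).PosSemidef)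
    (hA : ∀ u v, A u v = (‖A u v‖ : ℂ)) (hHA : ∀ u v, ‖H u v‖ ≤ ‖A u v‖) {x : V → ℂ}
    (hx : H *ᵥ x = (r : ℂ) • x) :
    A *ᵥ (fun v ↦ (‖x v‖ : ℂ)) = (r : ℂ) • (fun v ↦ (‖x v‖ : ℂ)) ∧
      ∀ u v, star (x u) * H u v * x v = A u v * ‖x u‖ * ‖x v‖ := by
  set y : V → ℂ := fun v ↦ (‖x v‖ : ℂ) with hy
  have hnorm : ∀ u v, ‖star (x u) * H u v * x v‖ ≤ ‖A u v‖ * ‖x u‖ * ‖x v‖ := fun u v ↦ by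
    rw [norm_mul, norm_mul, norm_star, mul_comm ‖x u‖]
    gcongr
    exact hHA u v
  have hre : ∀ u v, (star (x u) * H u v * x v).re ≤ ‖A u v‖ * ‖x u‖ * ‖x v‖ :=
    fun u v ↦ (Complex.re_le_norm _).trans (hnorm u v)
  have hsumH : ∑ u, ∑ v, (star (x u) * H u v * x v).re = r * ∑ u, ‖x u‖ ^ 2 := by
    have h : ∀ u, ∑ v, star (x u) * H u v * x v = ((r * ‖x u‖ ^ 2 : ℝ) : ℂ) := fun u ↦ by
      have h1 : ∑ v, H u v * x v = r * x u := congrFun hx u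
      simp_rw [mul_assoc, ← Finset.mul_sum, h1]
      push_cast
      rw [← Complex.conj_mul', starRingEnd_apply]
      ring
    rw [Finset.mul_sum]
    exact Finset.sum_congr rfl fun u _ ↦ by rw [← Complex.re_sum, h u, Complex.ofReal_re]
  have hform : star y ⬝ᵥ (((r : ℂ) • (1 : Matrix V V ℂ) - A) *ᵥ y) =
      ((r * ∑ u, ‖x u‖ ^ 2 - ∑ u, ∑ v, ‖A u v‖ * ‖x u‖ * ‖x v‖ : ℝ) : ℂ) := by
    rw [sub_mulVec, smul_mulVec, one_mulVec, dotProduct_sub]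
    push_cast
    congr 1
    · simp only [dotProduct, hy, Pi.star_apply, Pi.smul_apply, smul_eq_mul, Finset.mul_sum,
        Complex.star_def, Complex.conj_ofReal]
      exact Finset.sum_congr rfl fun u _ ↦ by ring
    · simp only [dotProduct, mulVec, hy, Pi.star_apply, Finset.mul_sum,
        Complex.star_def, Complex.conj_ofReal]
      refine Finset.sum_congr rfl fun u _ ↦ Finset.sum_congr rfl fun v _ ↦ ?_
      rw [← hA]
      ring
  have hle := hB.dotProduct_mulVec_nonneg y
  rw [hform, Complex.zero_le_real, ← hsumH, sub_nonneg] at hle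
  have hrow : ∀ u, ∑ v, (star (x u) * H u v * x v).re ≤ ∑ v, ‖A u v‖ * ‖x u‖ * ‖x v‖ :=
    fun u ↦ Finset.sum_le_sum fun v _ ↦ hre u v
  have hsum := (Finset.sum_le_sum fun u _ ↦ hrow u).antisymm hle
  constructor
  · rw [← hsumH, hsum, sub_self, Complex.ofReal_zero, hB.dotProduct_mulVec_zero_iff, sub_mulVec,
      smul_mulVec, one_mulVec, sub_eq_zero] at hform
    exact hform.symm
  · intro u v
    have h1 := (Finset.sum_eq_sum_iff_of_le fun u _ ↦ hrow u).1 hsum u (Finset.mem_univ u)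
    have h2 := (Finset.sum_eq_sum_iff_of_le fun v _ ↦ hre u v).1 h1 v (Finset.mem_univ v)
    have h3 : (star (x u) * H u v * x v).re = ‖star (x u) * H u v * x v‖ :=
      (Complex.re_le_norm _).antisymm (h2 ▸ hnorm u v)
    rw [Complex.eq_coe_norm_of_nonneg (Complex.re_eq_norm.1 h3), ← h3, h2, hA]
    simp

end

/-- A property that holds at some vertex of a connected graph and propagates along edges holds
at every vertex. -/
lemma SimpleGraph.Connected.forall_of_adj {V : Type*} {G : SimpleGraph V} (hG : G.Connected)
    {p : V → Prop} (hp : ∀ u v, G.Adj u v → p u → p v) {a : V} (ha : p a) (b : V) : p b := by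
  obtain ⟨w⟩ := hG.preconnected a b
  induction w with
  | nil => exact ha
  | cons h _ ih => exact ih (hp _ _ h ha)

/-- A nonzero eigenvector with nonnegative entries of a nonnegative matrix that is positive on the
edges of a connected graph has no zero entry. -/
lemma SimpleGraph.Connected.eigenvector_ne_zero {V : Type*} [Fintype V] {G : SimpleGraph V}
    (hG : G.Connected) {A : Matrix V V ℝ} (hA : ∀ u v, 0 ≤ A u v)
    (hpos : ∀ u v, G.Adj u v → A u v ≠ 0) {r : ℝ} {y : V → ℝ} (hy : ∀ v, 0 ≤ y v)
    (hy0 : y ≠ 0) (hAy : A *ᵥ y = r • y) (v : V) : y v ≠ 0 := by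
  intro hv
  refine hy0 (funext fun w ↦ hG.forall_of_adj (p := fun u ↦ y u = 0) (fun u v huv hu ↦ ?_) hv w)
  have h : ∑ v, A u v * y v = 0 := (congrFun hAy u).trans (by simp [hu])
  have h' := (Finset.sum_eq_zero_iff_of_nonneg fun v _ ↦ mul_nonneg (hA u v) (hy v)).1 h v
    (Finset.mem_univ v)
  exact (mul_eq_zero.1 h').resolve_left (hpos u v huv)

/-- If `G` is a connected simple graph with adjacency matrix `A`, `H` is the Hermitian adjacency
matrix of a mixed graph whose underlying graph is a spanning subgraph of `G`, and the largest
eigenvalue of `H` equals the largest eigenvalue of `A`, then the underlying graph of `H` is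
exactly `G` and the vertex set admits a partition `f : V → ZMod k` such that undirected edges
stay within a class and arcs go from class `s+1` to class `s`. -/
theorem stmt_5 {V : Type*} [Fintype V] [DecidableEq V] [Nonempty V]
    (k : ℕ) (hk : 3 ≤ k) (ω : ℂ)
    (hω : ω = Complex.exp (2 * (Real.pi : ℂ) * Complex.I / (k : ℂ)))
    (G : SimpleGraph V) (hconn : G.Connected)
    (A : Matrix V V ℂ)
    (hA1 : ∀ u v, G.Adj u v → A u v = 1)
    (hA0 : ∀ u v, ¬ G.Adj u v → A u v = 0)
    (hAherm : A.IsHermitian)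
    (H : Matrix V V ℂ) (hherm : H.IsHermitian) (hdiag : ∀ v, H v v = 0)
    (hent : ∀ u v, H u v ∈ ({0, 1, ω, (starRingEnd ℂ) ω} : Set ℂ))
    (hsub : ∀ u v, H u v ≠ 0 → G.Adj u v)
    (hlam : Finset.univ.sup' Finset.univ_nonempty hherm.eigenvalues =
        Finset.univ.sup' Finset.univ_nonempty hAherm.eigenvalues) :
    (∀ u v, H u v ≠ 0 ↔ G.Adj u v) ∧
      ∃ f : V → ZMod k, ∀ u v,
        (H u v = 1 → f u = f v) ∧ (H u v = ω → f u - f v = 1) := by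
  have hk0 : k ≠ 0 := by omega
  have hprim : IsPrimitiveRoot ω k := hω ▸ Complex.isPrimitiveRoot_exp k hk0
  have hω1 : ‖ω‖ = 1 := hprim.norm'_eq_one hk0
  have hω0 : ω ≠ 0 := hprim.ne_zero hk0
  have hconj : (starRingEnd ℂ) ω = ω⁻¹ := (Complex.inv_eq_conj hω1).symm
  have hval : ∀ u v, H u v = 0 ∨ H u v = 1 ∨ H u v = ω ∨ H u v = ω⁻¹ := fun u v ↦
    hconj ▸ hent u v
  have hH1 : ∀ u v, ‖H u v‖ ≤ 1 := fun u v ↦ by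
    rcases hval u v with h | h | h | h <;> simp [h, hω1]
  have hA : ∀ u v, A u v = (‖A u v‖ : ℂ) := fun u v ↦ by
    by_cases h : G.Adj u v
    · simp [hA1 u v h]
    · simp [hA0 u v h]
  have hHA : ∀ u v, ‖H u v‖ ≤ ‖A u v‖ := fun u v ↦ by
    by_cases h : H u v = 0
    · simp [h]
    · simpa [hA1 u v (hsub u v h)] using hH1 u v
  obtain ⟨i, -, hi⟩ := Finset.exists_mem_eq_sup' Finset.univ_nonempty hherm.eigenvalues
  set r : ℝ := hherm.eigenvalues i
  have hAr : ∀ j, hAherm.eigenvalues j ≤ r := fun j ↦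
    (Finset.le_sup' hAherm.eigenvalues (Finset.mem_univ j)).trans_eq (hlam.symm.trans hi)
  set x : V → ℂ := ⇑(hherm.eigenvectorBasis i)
  have hx : H *ᵥ x = (r : ℂ) • x := by
    simpa using hherm.mulVec_eigenvectorBasis i
  have hxne : x ≠ 0 := fun h ↦ hherm.eigenvectorBasis.orthonormal.ne_zero i
    (PiLp.ext fun v ↦ congrFun h v)
  obtain ⟨hAy, hterm⟩ := eigenvector_norm_of_dominated (posSemidef_smul_one_sub hAherm hAr) hA hHA hx
  have hx0 : ∀ v, x v ≠ 0 := fun v ↦ by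
    rw [← norm_ne_zero_iff]
    refine hconn.eigenvector_ne_zero (A := fun u v ↦ ‖A u v‖) (r := r) (y := fun v ↦ ‖x v‖)
      (fun _ _ ↦ norm_nonneg _) (fun u v h ↦ by simp [hA1 u v h]) (fun _ ↦ norm_nonneg _)
      (fun h ↦ hxne (funext fun v ↦ norm_eq_zero.1 (congrFun h v))) (funext fun u ↦ ?_) v
    have h : ∑ v, (‖A u v‖ : ℂ) * ‖x v‖ = r * ‖x u‖ := by
      simp_rw [← hA]
      exact congrFun hAy u
    exact_mod_cast h
  have hy0 : ∀ v, (‖x v‖ : ℂ) ≠ 0 := fun v ↦ by simpa using hx0 v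
  have hadj : ∀ u v, G.Adj u v → H u v ≠ 0 := fun u v huv h0 ↦ by
    have h := hterm u v
    rw [h0, hA1 u v huv] at h
    simp [hx0] at h
  refine ⟨fun u v ↦ ⟨hsub u v, hadj u v⟩, ?_⟩
  set θ : V → ℂ := fun v ↦ x v / ‖x v‖ with hθ
  have hθ0 : ∀ v, θ v ≠ 0 := fun v ↦ div_ne_zero (hx0 v) (hy0 v)
  have hphase : ∀ u v, G.Adj u v → θ u = H u v * θ v := fun u v huv ↦ by
    have h := hterm u v
    have hn : star (x u) * x u = (‖x u‖ : ℂ) ^ 2 := Complex.conj_mul' (x u)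
    rw [hA1 u v huv, one_mul] at h
    have hs : star (x u) ≠ 0 := star_ne_zero.2 (hx0 u)
    rw [hθ]
    field_simp [hy0 u, hy0 v]
    apply mul_left_cancel₀ hs
    linear_combination (‖x v‖ : ℂ) * hn - (‖x u‖ : ℂ) * h
  obtain ⟨a⟩ := ‹Nonempty V›
  have hpow : ∀ v, ∃ n : ℤ, θ v = ω ^ n * θ a := by
    refine hconn.forall_of_adj (a := a) (fun u v huv ⟨n, hn⟩ ↦ ?_) ⟨0, by simp⟩
    have h := hphase v u huv.symm
    rw [hn] at h
    rcases hval v u with h0 | h1 | h1 | h1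
    · exact absurd h0 (hadj v u huv.symm)
    · exact ⟨n, by rw [h, h1, one_mul]⟩
    · exact ⟨1 + n, by rw [h, h1, zpow_add₀ hω0, zpow_one, mul_assoc]⟩
    · exact ⟨-1 + n, by rw [h, h1, zpow_add₀ hω0, _root_.zpow_neg_one, mul_assoc]⟩
  choose f hf using hpow
  have hclass : ∀ u v (m : ℤ), H u v = ω ^ m → (f u : ZMod k) - f v = m := fun u v m hm ↦ by
    have h := hphase u v (hsub u v (hm ▸ zpow_ne_zero m hω0))
    rw [hm, hf u, hf v, ← mul_assoc, ← zpow_add₀ hω0] at h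
    have h' := mul_right_cancel₀ (hθ0 a) h
    have h1 : ω ^ (f u - (m + f v)) = 1 := by
      rw [zpow_sub₀ hω0, h', div_self (zpow_ne_zero _ hω0)]
    rw [hprim.zpow_eq_one_iff_dvd, ← ZMod.intCast_zmod_eq_zero_iff_dvd] at h1
    push_cast at h1
    linear_combination h1
  refine ⟨fun v ↦ f v, fun u v ↦ ⟨fun h ↦ ?_, fun h ↦ ?_⟩⟩
  · simpa [sub_eq_zero] using hclass u v 0 (by simpa using h)
  · simpa using hclass u v 1 (by simpa using h)
end

section
/- Let k ≥ 3 be an integer, ω = exp(2πi/k), G a simple graph on a finite nonempty vertex set V with 0/1 adjacency matrix A (viewed as a complex matrix), and let H be the Hermitian adjacency matrix of a mixed graph on V whose underlying graph is exactly G (H u v ≠ 0 iff u and v are adjacent in G). Suppose there exists f : V → ZMod k such that for all u, v: if H u v = 1 then f u = f v, and if H u v = ω then f u − f v = 1 in ZMod k. Then H and A are cospectral: the characteristic polynomial of H equals the characteristic polynomial of A. (In fact D⁻¹ H D = A for the diagonal matrix D with diagonal entries D v v = ω^(f v).) -/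
open Matrix

/-- Matrices conjugate by a diagonal matrix with nonzero entries are cospectral. -/
theorem Matrix.charpoly_eq_of_mul_diagonal {n K : Type*} [Fintype n] [DecidableEq n] [Field K]
    {M N : Matrix n n K} {d : n → K} (hd : ∀ i, d i ≠ 0)
    (h : M * diagonal d = diagonal d * N) : M.charpoly = N.charpoly := by
  have hunit : IsUnit (diagonal d) :=
    isUnit_diagonal.2 (Pi.isUnit_iff.2 fun i => (hd i).isUnit)
  obtain ⟨D, hD⟩ := hunit
  rw [← hD] at h
  rw [← charpoly_units_conj D N, ← h, mul_assoc, ← coe_units_inv,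
    Units.mul_inv, mul_one]

theorem ZMod.stdAddChar_one (k : ℕ) [NeZero k] :
    ZMod.stdAddChar (1 : ZMod k) =
      Complex.exp (2 * (Real.pi : ℂ) * Complex.I / (k : ℂ)) := by
  simpa using ZMod.stdAddChar_coe (N := k) 1

/-- If the underlying graph of the mixed graph `H` is exactly `G` (with adjacency matrix `A`),
and there is a partition `f : V → ZMod k` such that undirected edges stay within a class and
arcs go from class `s+1` to class `s`, then `H` and `A` are cospectral. -/
theorem stmt_6 {V : Type*} [Fintype V] [DecidableEq V] [Nonempty V]
    (k : ℕ) (hk : 3 ≤ k) (ω : ℂ)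
    (hω : ω = Complex.exp (2 * (Real.pi : ℂ) * Complex.I / (k : ℂ)))
    (G : SimpleGraph V)
    (A : Matrix V V ℂ)
    (hA1 : ∀ u v, G.Adj u v → A u v = 1)
    (hA0 : ∀ u v, ¬ G.Adj u v → A u v = 0)
    (H : Matrix V V ℂ) (hherm : H.IsHermitian) (hdiag : ∀ v, H v v = 0)
    (hent : ∀ u v, H u v ∈ ({0, 1, ω, (starRingEnd ℂ) ω} : Set ℂ))
    (hund : ∀ u v, H u v ≠ 0 ↔ G.Adj u v)
    (f : V → ZMod k)
    (hf1 : ∀ u v, H u v = 1 → f u = f v)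
    (hfω : ∀ u v, H u v = ω → f u - f v = 1) :
    H.charpoly = A.charpoly := by
  have : NeZero k := ⟨by omega⟩
  rw [← ZMod.stdAddChar_one k] at hω
  have hmul : ω * (starRingEnd ℂ) ω = 1 := by
    rw [hω, ← AddChar.map_neg_eq_conj, ← AddChar.map_add_eq_mul, add_neg_cancel,
      AddChar.map_zero_eq_one]
  have hstep : ∀ u v, H u v = ω →
      ZMod.stdAddChar (f u) = ω * ZMod.stdAddChar (f v) := fun u v h => by
    rw [hω, ← AddChar.map_add_eq_mul, ← hfω u v h, sub_add_cancel]
  refine charpoly_eq_of_mul_diagonal (d := fun v => ZMod.stdAddChar (f v))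
    (fun v => Circle.coe_ne_zero _) ?_
  ext u v
  rw [mul_diagonal, diagonal_mul]
  by_cases hadj : G.Adj u v
  · rw [hA1 u v hadj, mul_one]
    rcases hent u v with h | h | h | h
    · exact absurd h ((hund u v).2 hadj)
    · rw [h, one_mul, hf1 u v h]
    · rw [h, hstep u v h]
    · have h' : H v u = ω := by
        rw [← hherm.apply v u, h]
        exact Complex.conj_conj ω
      rw [h, hstep v u h', ← mul_assoc, mul_comm _ ω, hmul, one_mul]
  · rw [hA0 u v hadj, not_not.1 (mt (hund u v).1 hadj), zero_mul, mul_zero]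
end

section
/- Let k ≥ 3 be an integer, ω = exp(2πi/k), and let H be the Hermitian adjacency matrix of a mixed graph on a finite nonempty vertex set V whose underlying graph is d-regular (every vertex has exactly d neighbors). Suppose there exists f : V → ZMod k such that for all u, v: if H u v = 1 then f u = f v, and if H u v = ω then f u − f v = 1 in ZMod k. Then the vector x with x v = ω^(f v) satisfies H x = d • x; in particular d is an eigenvalue of H and the spectral radius of H equals d. -/
open Matrix

/-- If `ω ^ k = 1`, then adding `1` to an exponent in `ZMod k` multiplies the power by `ω`. -/
theorem pow_val_add_one_of_pow_eq_one {k : ℕ} [NeZero k] {ω : ℂ} (h : ω ^ k = 1) (a : ZMod k) :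
    ω ^ (a + 1).val = ω * ω ^ a.val := by
  rw [ZMod.val_add, ZMod.val_one_eq_one_mod, Nat.add_mod_mod, ← pow_eq_pow_mod _ h, pow_succ,
    mul_comm]

/-- If the entries of a Hermitian matrix have norm at most one and vanish outside the edges of a
`d`-regular graph, then its eigenvalues are bounded by `d` in absolute value. -/
theorem abs_eigenvalues_le_of_isRegularOfDegree {V : Type*} [Fintype V] [DecidableEq V]
    {H : Matrix V V ℂ} (hherm : H.IsHermitian) {G : SimpleGraph V} [DecidableRel G.Adj] {d : ℕ}
    (hreg : G.IsRegularOfDegree d) (hH : ∀ u v, ‖H u v‖ ≤ if G.Adj u v then 1 else 0) (i : V) :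
    |hherm.eigenvalues i| ≤ d := by
  have hev : Module.End.HasEigenvalue (Matrix.toLin' H) (hherm.eigenvalues i : ℂ) := by
    rw [Module.End.hasEigenvalue_iff_mem_spectrum, Matrix.spectrum_toLin',
      hherm.spectrum_eq_image_range]
    exact ⟨_, ⟨i, rfl⟩, rfl⟩
  obtain ⟨u, hu⟩ := eigenvalue_mem_ball hev
  have hdiag : H u u = 0 := by simpa using hH u u
  rw [hdiag, mem_closedBall_zero_iff] at hu
  calc |hherm.eigenvalues i| = ‖(hherm.eigenvalues i : ℂ)‖ := by simp
    _ ≤ ∑ v ∈ Finset.univ.erase u, ‖H u v‖ := hu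
    _ ≤ ∑ v, ‖H u v‖ :=
      Finset.sum_le_sum_of_subset_of_nonneg (Finset.erase_subset _ _) fun _ _ _ => norm_nonneg _
    _ ≤ ∑ v, if G.Adj u v then (1 : ℝ) else 0 := Finset.sum_le_sum fun v _ => hH u v
    _ = d := by
      rw [← hreg u, Finset.sum_boole, ← G.card_neighborFinset_eq_degree,
        G.neighborFinset_eq_filter]

/-- If the underlying graph of the mixed graph `H` is `d`-regular and the vertex set admits a
partition `f : V → ZMod k` such that undirected edges stay within a class and arcs go from class
`s+1` to class `s`, then the vector `x v = ω^(f v)` satisfies `H x = d • x`; in particular `d`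
is an eigenvalue of `H` and the spectral radius of `H` equals `d`. -/
theorem stmt_8 {V : Type*} [Fintype V] [DecidableEq V] [Nonempty V]
    (k : ℕ) (hk : 3 ≤ k) (ω : ℂ)
    (hω : ω = Complex.exp (2 * (Real.pi : ℂ) * Complex.I / (k : ℂ)))
    (H : Matrix V V ℂ) (hherm : H.IsHermitian) (hdiag : ∀ v, H v v = 0)
    (hent : ∀ u v, H u v ∈ ({0, 1, ω, (starRingEnd ℂ) ω} : Set ℂ))
    (G : SimpleGraph V) [DecidableRel G.Adj]
    (hadj : ∀ u v, G.Adj u v ↔ u ≠ v ∧ H u v ≠ 0)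
    (d : ℕ) (hreg : G.IsRegularOfDegree d)
    (f : V → ZMod k)
    (hf1 : ∀ u v, H u v = 1 → f u = f v)
    (hfω : ∀ u v, H u v = ω → f u - f v = 1) :
    H.mulVec (fun v => ω ^ (f v).val) = (d : ℂ) • (fun v => ω ^ (f v).val) ∧
      (∃ y : V → ℂ, y ≠ 0 ∧ H.mulVec y = (d : ℂ) • y) ∧
      Finset.univ.sup' Finset.univ_nonempty (fun i => |hherm.eigenvalues i|) = (d : ℝ) := by
  have : NeZero k := ⟨by omega⟩
  have hroot : IsPrimitiveRoot ω k := hω ▸ Complex.isPrimitiveRoot_exp k (NeZero.ne k)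
  have hnorm : ‖ω‖ = 1 := hroot.norm'_eq_one (NeZero.ne k)
  have hω0 : ω ≠ 0 := hroot.ne_zero (NeZero.ne k)
  have hconj : starRingEnd ℂ ω * ω = 1 := by
    rw [mul_comm, Complex.mul_conj, Complex.normSq_eq_norm_sq, hnorm]; simp
  have hstep : ∀ u v, f u - f v = 1 → ω ^ (f u).val = ω * ω ^ (f v).val := fun u v h => by
    rw [sub_eq_iff_eq_add'.mp h, pow_val_add_one_of_pow_eq_one hroot.pow_eq_one]
  have hterm : ∀ u v, H u v * ω ^ (f v).val = if G.Adj u v then ω ^ (f u).val else 0 := by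
    intro u v
    by_cases h0 : H u v = 0
    · simp [hadj, h0]
    have huv : G.Adj u v := (hadj u v).2 ⟨by rintro rfl; exact h0 (hdiag u), h0⟩
    rw [if_pos huv]
    obtain h | h | h | h := hent u v
    · exact absurd h h0
    · rw [h, hf1 u v h, one_mul]
    · rw [h, hstep u v (hfω u v h)]
    · have hvu : H v u = ω := by
        rw [← hherm.apply v u, show H u v = starRingEnd ℂ ω from h]
        exact Complex.conj_conj ω
      rw [show H u v = starRingEnd ℂ ω from h, hstep v u (hfω v u hvu), ← mul_assoc, hconj,
        one_mul]
  have hH : ∀ u v, ‖H u v‖ ≤ if G.Adj u v then 1 else 0 := fun u v => by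
    have h := congrArg norm (hterm u v)
    rw [norm_mul, norm_pow, hnorm, one_pow, mul_one] at h
    rw [h]
    split_ifs <;> simp [hnorm]
  have hx : H.mulVec (fun v => ω ^ (f v).val) = (d : ℂ) • (fun v => ω ^ (f v).val) := by
    ext u
    simp_rw [Matrix.mulVec, dotProduct, hterm]
    rw [← Finset.sum_filter, Finset.sum_const, ← G.neighborFinset_eq_filter,
      G.card_neighborFinset_eq_degree, hreg u]
    simp
  have hx0 : (fun v => ω ^ (f v).val) ≠ 0 := fun h =>
    pow_ne_zero _ hω0 (congrFun h (Classical.arbitrary V))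
  refine ⟨hx, ⟨_, hx0, hx⟩, le_antisymm ?_ ?_⟩
  · exact Finset.sup'_le _ _ fun i _ => abs_eigenvalues_le_of_isRegularOfDegree hherm hreg hH i
  · have hev : Module.End.HasEigenvalue (Matrix.toLin' H) (d : ℂ) :=
      Module.End.hasEigenvalue_of_hasEigenvector
        (Module.End.hasEigenvector_iff.2
          ⟨Module.End.mem_eigenspace_iff.2 (by rw [Matrix.toLin'_apply, hx]), hx0⟩)
    rw [Module.End.hasEigenvalue_iff_mem_spectrum, Matrix.spectrum_toLin',
      hherm.spectrum_eq_image_range] at hev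
    obtain ⟨_, ⟨i, rfl⟩, hi⟩ := hev
    have hi' : hherm.eigenvalues i = d := Complex.ofReal_injective (by simpa using hi)
    calc (d : ℝ) = |hherm.eigenvalues i| := by rw [hi', Nat.abs_cast]
      _ ≤ _ := Finset.le_sup' (fun i => |hherm.eigenvalues i|) (Finset.mem_univ i)
end

section
/- Let k ≥ 4 be an even integer, ω = exp(2πi/k), and let H be the Hermitian adjacency matrix of a mixed graph on a finite nonempty vertex set V whose underlying graph is d-regular. Suppose there exists f : V → ZMod k such that for all u, v: if H u v = 1 then f v − f u = k/2 in ZMod k, and if H u v = ω then f v − f u = k/2 − 1 in ZMod k. Then the vector x with x v = ω^(f v) satisfies H x = (−d) • x; in particular −d is an eigenvalue of H and the spectral radius of H equals d. -/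
open Matrix

/-- If `ω ^ k = 1`, the powers `ω ^ a` for `a : ZMod k` convert addition into multiplication. -/
theorem ZMod.pow_val_add_natCast {M : Type*} [Monoid M] {k : ℕ} [NeZero k] {ω : M}
    (h : ω ^ k = 1) (a : ZMod k) (n : ℕ) : ω ^ (a + n).val = ω ^ a.val * ω ^ n := by
  rw [← pow_add]
  refine pow_eq_pow_of_modEq ?_ h
  rw [← ZMod.natCast_eq_natCast_iff]
  simp

theorem Complex.exp_two_pi_div_pow_half {k : ℕ} (hk : k ≠ 0) (hkeven : Even k) :
    Complex.exp (2 * (Real.pi : ℂ) * Complex.I / (k : ℂ)) ^ (k / 2) = -1 := by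
  obtain ⟨m, rfl⟩ := hkeven
  have hm : (m : ℂ) ≠ 0 := by
    rintro h
    exact hk (by simp [Nat.cast_eq_zero.mp h])
  rw [← Complex.exp_nat_mul, show (m + m) / 2 = m by omega, ← Complex.exp_pi_mul_I]
  congr 1
  push_cast
  field_simp
  ring

/-- If every row of the matrix `A` has absolute sum at most `r`, every eigenvalue has
norm at most `r`. -/
theorem Matrix.norm_le_of_hasEigenvalue_of_sum_norm_le {K n : Type*} [NormedField K] [Fintype n]
    [DecidableEq n] {A : Matrix n n K} {r : ℝ} (hA : ∀ i, ∑ j, ‖A i j‖ ≤ r) {μ : K}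
    (hμ : Module.End.HasEigenvalue (Matrix.toLin' A) μ) : ‖μ‖ ≤ r := by
  obtain ⟨i, hi⟩ := eigenvalue_mem_ball hμ
  rw [mem_closedBall_iff_norm] at hi
  calc ‖μ‖ = ‖(μ - A i i) + A i i‖ := by rw [sub_add_cancel]
    _ ≤ ‖μ - A i i‖ + ‖A i i‖ := norm_add_le _ _
    _ ≤ ∑ j ∈ Finset.univ.erase i, ‖A i j‖ + ‖A i i‖ := by gcongr
    _ = ∑ j, ‖A i j‖ := Finset.sum_erase_add _ _ (Finset.mem_univ i)
    _ ≤ r := hA i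

theorem Matrix.hasEigenvalue_toLin'_of_mulVec_eq {R n : Type*} [CommRing R] [Fintype n]
    [DecidableEq n] {A : Matrix n n R} {μ : R} {y : n → R} (hy : y ≠ 0) (h : A *ᵥ y = μ • y) :
    Module.End.HasEigenvalue (Matrix.toLin' A) μ :=
  Module.End.hasEigenvalue_of_hasEigenvector
    ⟨Module.End.mem_eigenspace_iff.mpr (by rwa [Matrix.toLin'_apply]), hy⟩

/-- If the rows of a Hermitian matrix have absolute sum at most `r` and `-r` is an eigenvalue, then
`r` is the largest absolute value of an eigenvalue. -/
theorem Matrix.IsHermitian.sup'_abs_eigenvalues_eq {n : Type*} [Fintype n] [DecidableEq n]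
    [Nonempty n] {A : Matrix n n ℂ} (hA : A.IsHermitian) {r : ℝ} (hr : 0 ≤ r)
    (hsum : ∀ i, ∑ j, ‖A i j‖ ≤ r)
    {y : n → ℂ} (hy : y ≠ 0) (h : A *ᵥ y = (-(r : ℂ)) • y) :
    Finset.univ.sup' Finset.univ_nonempty (fun i => |hA.eigenvalues i|) = r := by
  have hspec : -r ∈ spectrum ℝ A := by
    apply spectrum.of_algebraMap_mem ℂ
    rw [← Matrix.spectrum_toLin', ← Module.End.hasEigenvalue_iff_mem_spectrum]
    apply Matrix.hasEigenvalue_toLin'_of_mulVec_eq hy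
    simpa using h
  rw [hA.spectrum_real_eq_range_eigenvalues] at hspec
  obtain ⟨i, hi⟩ := hspec
  apply le_antisymm
  · refine Finset.sup'_le _ _ fun j _ => ?_
    have hj : Module.End.HasEigenvalue (Matrix.toLin' A) (hA.eigenvalues j : ℂ) := by
      rw [Module.End.hasEigenvalue_iff_mem_spectrum, Matrix.spectrum_toLin']
      exact spectrum.algebraMap_mem ℂ (hA.eigenvalues_mem_spectrum_real j)
    simpa using Matrix.norm_le_of_hasEigenvalue_of_sum_norm_le hsum hj
  · refine le_trans ?_ (Finset.le_sup' _ (Finset.mem_univ i))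
    simp [hi, abs_of_nonneg hr]

/-- Let `k ≥ 4` be even. If the underlying graph of the mixed graph `H` is `d`-regular and the
vertex set admits a partition `f : V → ZMod k` such that along each undirected edge `f`
increases by `k/2` and along each arc `f` increases by `k/2 - 1`, then the vector
`x v = ω^(f v)` satisfies `H x = (-d) • x`; in particular `-d` is an eigenvalue of `H` and the
spectral radius of `H` equals `d`. -/
theorem stmt_9 {V : Type*} [Fintype V] [DecidableEq V] [Nonempty V]
    (k : ℕ) (hk : 4 ≤ k) (hkeven : Even k) (ω : ℂ)
    (hω : ω = Complex.exp (2 * (Real.pi : ℂ) * Complex.I / (k : ℂ)))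
    (H : Matrix V V ℂ) (hherm : H.IsHermitian) (hdiag : ∀ v, H v v = 0)
    (hent : ∀ u v, H u v ∈ ({0, 1, ω, (starRingEnd ℂ) ω} : Set ℂ))
    (G : SimpleGraph V) [DecidableRel G.Adj]
    (hadj : ∀ u v, G.Adj u v ↔ u ≠ v ∧ H u v ≠ 0)
    (d : ℕ) (hreg : G.IsRegularOfDegree d)
    (f : V → ZMod k)
    (hf1 : ∀ u v, H u v = 1 → f v - f u = ((k / 2 : ℕ) : ZMod k))
    (hfω : ∀ u v, H u v = ω → f v - f u = ((k / 2 : ℕ) : ZMod k) - 1) :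
    H.mulVec (fun v => ω ^ (f v).val) = (-(d : ℂ)) • (fun v => ω ^ (f v).val) ∧
      (∃ y : V → ℂ, y ≠ 0 ∧ H.mulVec y = (-(d : ℂ)) • y) ∧
      Finset.univ.sup' Finset.univ_nonempty (fun i => |hherm.eigenvalues i|) = (d : ℝ) := by
  have : NeZero k := ⟨by omega⟩
  have hhalf : ω ^ (k / 2) = -1 := by
    rw [hω]; exact Complex.exp_two_pi_div_pow_half (by omega) hkeven
  have hωk : ω ^ k = 1 := by
    rw [← Nat.div_mul_cancel hkeven.two_dvd, pow_mul, hhalf]; norm_num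
  have hωnorm : ‖ω‖ = 1 := Complex.norm_eq_one_of_pow_eq_one hωk (by omega)
  have hconj : (starRingEnd ℂ) ω * ω = 1 := by rw [Complex.conj_mul', hωnorm]; norm_num
  have hω0 : ω ≠ 0 := by rw [← norm_ne_zero_iff, hωnorm]; exact one_ne_zero
  have hshift : ∀ u v, f v - f u = ((k / 2 : ℕ) : ZMod k) - 1 →
      ω ^ (f v).val * ω = -ω ^ (f u).val := by
    intro u v h
    have h' : f v + (1 : ℕ) = f u + (k / 2 : ℕ) := by
      push_cast
      linear_combination h
    have := congrArg (fun a : ZMod k => ω ^ a.val) h'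
    simpa only [ZMod.pow_val_add_natCast hωk, hhalf, pow_one, mul_neg, mul_one] using this
  have hentry : ∀ u v, H u v * ω ^ (f v).val = if G.Adj u v then -ω ^ (f u).val else 0 := by
    intro u v
    by_cases h0 : H u v = 0
    · simp [hadj, h0]
    have huv : u ≠ v := by
      rintro rfl
      exact h0 (hdiag u)
    rw [if_pos ((hadj u v).2 ⟨huv, h0⟩)]
    obtain h | h | h | h := hent u v
    · exact absurd h h0
    · have h' : f v = f u + (k / 2 : ℕ) := by linear_combination hf1 u v h
      rw [h, h', ZMod.pow_val_add_natCast hωk, hhalf]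
      ring
    · rw [h, mul_comm, hshift u v (hfω u v h)]
    · have hvu : H v u = ω := by
        rw [← hherm.apply v u, h]
        simp
      rw [h]
      linear_combination (starRingEnd ℂ) ω * hshift v u (hfω v u hvu) - ω ^ (f u).val * hconj
  have hnorm : ∀ u v, ‖H u v‖ = if G.Adj u v then 1 else 0 := by
    intro u v
    have := congrArg norm (hentry u v)
    simpa [apply_ite norm, hωnorm] using this
  have hmul : H.mulVec (fun v => ω ^ (f v).val) = (-(d : ℂ)) • (fun v => ω ^ (f v).val) := by
    funext u
    simp [Matrix.mulVec, dotProduct, hentry, Finset.sum_ite, ← SimpleGraph.neighborFinset_eq_filter,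
      hreg.degree_eq u]
  have hne : (fun v => ω ^ (f v).val) ≠ 0 := fun h =>
    pow_ne_zero _ hω0 (congrFun h (Classical.arbitrary V))
  refine ⟨hmul, ⟨_, hne, hmul⟩, ?_⟩
  refine hherm.sup'_abs_eigenvalues_eq (Nat.cast_nonneg d) (fun u => ?_) hne (by simpa using hmul)
  simp [hnorm, ← SimpleGraph.neighborFinset_eq_filter, hreg.degree_eq u]
end

section
/- Let k ≥ 3 be an odd integer and let H be the Hermitian adjacency matrix of a connected mixed graph on a finite nonempty vertex set V, with Δ the maximum degree of the underlying graph. If −Δ is an eigenvalue of H, then Δ is also an eigenvalue of H. -/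
open Matrix

/-- A sum weighted by row `u` of `H` only sees the neighbours of `u`. -/
lemma mulVec_apply_eq_sum_neighborFinset {V : Type*} [Fintype V] {H : Matrix V V ℂ}
    {G : SimpleGraph V} [DecidableRel G.Adj] (hzero : ∀ u v, ¬ G.Adj u v → H u v = 0)
    (x : V → ℂ) (u : V) :
    H.mulVec x u = ∑ v ∈ G.neighborFinset u, H u v * x v := by
  rw [Matrix.mulVec, dotProduct]
  refine (Finset.sum_subset (Finset.subset_univ _) fun v _ hv => ?_).symm
  rw [hzero u v (by simpa using hv), zero_mul]

/-- If `x` is an eigenvector for `-Δ` of a matrix with unimodular entries on the edges of `G`, then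
at a vertex `u` where `‖x u‖` is maximal and nonzero, the degree is `Δ` and every neighbour `v`
satisfies `H u v * x v = -x u`. -/
lemma degree_eq_and_mul_eq_neg_of_norm_le {V : Type*} [Fintype V] {H : Matrix V V ℂ}
    {G : SimpleGraph V} [DecidableRel G.Adj] (hzero : ∀ u v, ¬ G.Adj u v → H u v = 0)
    (hnorm : ∀ u v, G.Adj u v → ‖H u v‖ = 1) {x : V → ℂ}
    (hx : H.mulVec x = (-(G.maxDegree : ℂ)) • x) {u : V} (hu : x u ≠ 0)
    (hmax : ∀ v, ‖x v‖ ≤ ‖x u‖) :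
    G.degree u = G.maxDegree ∧ ∀ v, G.Adj u v → H u v * x v = -x u := by
  have hpos : 0 < ‖x u‖ ^ 2 := by positivity
  have hdeg : (G.degree u : ℝ) ≤ G.maxDegree := by exact_mod_cast G.degree_le_maxDegree u
  have hsum : ∑ v ∈ G.neighborFinset u, (H u v * x v * (starRingEnd ℂ) (x u)).re
      = -(G.maxDegree * ‖x u‖ ^ 2) := by
    rw [← Complex.re_sum, ← Finset.sum_mul, ← mulVec_apply_eq_sum_neighborFinset hzero, hx,
      Pi.smul_apply, smul_eq_mul, mul_assoc, Complex.mul_conj, Complex.normSq_eq_norm_sq]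
    norm_cast
    simp
  have hterm : ∀ v ∈ G.neighborFinset u, ‖H u v * x v + x u‖ ^ 2
      ≤ 2 * ‖x u‖ ^ 2 + 2 * (H u v * x v * (starRingEnd ℂ) (x u)).re := by
    intro v hv
    have hle : ‖x v‖ ^ 2 ≤ ‖x u‖ ^ 2 := by gcongr; exact hmax v
    rw [← Complex.normSq_eq_norm_sq, Complex.normSq_add, Complex.normSq_eq_norm_sq,
      Complex.normSq_eq_norm_sq, norm_mul, hnorm u v (by simpa using hv), one_mul]
    linarith
  have htotal : ∑ v ∈ G.neighborFinset u, ‖H u v * x v + x u‖ ^ 2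
      ≤ 2 * ((G.degree u - G.maxDegree) * ‖x u‖ ^ 2) := by
    refine (Finset.sum_le_sum hterm).trans_eq ?_
    rw [Finset.sum_add_distrib, ← Finset.mul_sum, ← Finset.mul_sum, hsum, Finset.sum_const,
      G.card_neighborFinset_eq_degree, nsmul_eq_mul]
    ring
  have hnonneg : 0 ≤ ∑ v ∈ G.neighborFinset u, ‖H u v * x v + x u‖ ^ 2 :=
    Finset.sum_nonneg fun _ _ => sq_nonneg _
  have hdeg_eq : (G.degree u : ℝ) = G.maxDegree := by nlinarith
  refine ⟨by exact_mod_cast hdeg_eq, fun v hv => ?_⟩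
  rw [hdeg_eq, sub_self, zero_mul, mul_zero] at htotal
  have h := (Finset.sum_eq_zero_iff_of_nonneg fun _ _ => sq_nonneg _).1
    (le_antisymm htotal hnonneg) v (by simpa using hv)
  exact eq_neg_of_add_eq_zero_left (by simpa using h)

/-- Let `k ≥ 3` be odd. If `-Δ` is an eigenvalue of the Hermitian adjacency matrix of a
connected mixed graph `H`, then `Δ` is also an eigenvalue of `H`. -/
theorem stmt_13 {V : Type*} [Fintype V] [DecidableEq V] [Nonempty V]
    (k : ℕ) (hk : 3 ≤ k) (hkodd : Odd k) (ω : ℂ)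
    (hω : ω = Complex.exp (2 * (Real.pi : ℂ) * Complex.I / (k : ℂ)))
    (H : Matrix V V ℂ) (hherm : H.IsHermitian) (hdiag : ∀ v, H v v = 0)
    (hent : ∀ u v, H u v ∈ ({0, 1, ω, (starRingEnd ℂ) ω} : Set ℂ))
    (G : SimpleGraph V) [DecidableRel G.Adj]
    (hadj : ∀ u v, G.Adj u v ↔ u ≠ v ∧ H u v ≠ 0)
    (hconn : G.Connected)
    (heig : ∃ x : V → ℂ, x ≠ 0 ∧ H.mulVec x = (-(G.maxDegree : ℂ)) • x) :
    ∃ y : V → ℂ, y ≠ 0 ∧ H.mulVec y = (G.maxDegree : ℂ) • y := by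
  have hzero : ∀ u v, ¬ G.Adj u v → H u v = 0 := by
    intro u v h
    by_contra hne
    refine h ((hadj u v).2 ⟨?_, hne⟩)
    rintro rfl
    exact hne (hdiag u)
  have hk0 : k ≠ 0 := by omega
  have hωk : ω ^ k = 1 := hω ▸ (Complex.isPrimitiveRoot_exp k hk0).pow_eq_one
  have hpow : ∀ u v, G.Adj u v → H u v ^ k = 1 := by
    intro u v h
    rcases hent u v with h0 | h1 | h2 | h3
    · exact absurd h0 ((hadj u v).1 h).2
    · rw [h1, one_pow]
    · rw [h2, hωk]
    · rw [h3, ← map_pow, hωk, map_one]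
  have hnorm : ∀ u v, G.Adj u v → ‖H u v‖ = 1 :=
    fun u v h => Complex.norm_eq_one_of_pow_eq_one (hpow u v h) hk0
  obtain ⟨x, hx0, hx⟩ := heig
  obtain ⟨w, hw⟩ := Finite.exists_max fun v => ‖x v‖
  have hxw : 0 < ‖x w‖ := by
    obtain ⟨v, hv⟩ := Function.ne_iff.1 hx0
    exact (norm_pos_iff.2 hv).trans_le (hw v)
  have hlocal : ∀ u, ‖x u‖ = ‖x w‖ →
      G.degree u = G.maxDegree ∧ ∀ v, G.Adj u v → H u v * x v = -x u := fun u hu =>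
    degree_eq_and_mul_eq_neg_of_norm_le hzero hnorm hx (norm_pos_iff.1 (hu ▸ hxw)) (hu ▸ hw)
  have hconst : ∀ u, ‖x u‖ = ‖x w‖ := by
    intro u
    have hreach := (SimpleGraph.reachable_iff_reflTransGen w u).1 (hconn.preconnected w u)
    induction hreach with
    | refl => rfl
    | @tail a b _ hab ih =>
      have h := congrArg norm ((hlocal a ih).2 b hab)
      rwa [norm_mul, hnorm a b hab, one_mul, norm_neg, ih] at h
  refine ⟨fun v => x v ^ (k + 1), fun h => ?_, funext fun u => ?_⟩
  · exact pow_ne_zero (k + 1) (norm_pos_iff.1 hxw) (congrFun h w)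
  · obtain ⟨hdeg, hnbr⟩ := hlocal u (hconst u)
    have hterm : ∀ v ∈ G.neighborFinset u, H u v * x v ^ (k + 1) = x u ^ (k + 1) := by
      intro v hv
      have huv : G.Adj u v := by simpa using hv
      calc H u v * x v ^ (k + 1) = (H u v * x v) ^ (k + 1) := by
            rw [mul_pow, pow_succ (H u v), hpow u v huv, one_mul]
        _ = x u ^ (k + 1) := by rw [hnbr v huv, hkodd.add_one.neg_pow]
    rw [mulVec_apply_eq_sum_neighborFinset hzero, Finset.sum_congr rfl hterm, Finset.sum_const,
      G.card_neighborFinset_eq_degree, hdeg, nsmul_eq_mul, Pi.smul_apply, smul_eq_mul]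
end
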